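/- Let φ and Φ denote the density and the cumulative distribution function of the standard normal distribution, and for y ≥ 0 set α₀(y) = φ(y)/(1−Φ(y)). Then: (a) for every w ≥ 1 and every y ≥ 0, α₀(y) ≤ α₀(wy) ≤ (1+w)·α₀(y), so that w ≤ w·α₀(wy)/α₀(y) ≤ w² + w; and (b) for every 0 < w ≤ 1 and every y ≥ 0, (w/(1+w))·α₀(y) ≤ α₀(wy) ≤ α₀(y), so that w²/(1+w) ≤ w·α₀(wy)/α₀(y) ≤ w. -/

import Mathlib

open MeasureTheory

/-- The standard normal density `φ`. -/
noncomputable def stdNormalPDF (x : ℝ) : ℝ :=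
  Real.exp (-(x ^ 2) / 2) / Real.sqrt (2 * Real.pi)

/-- The standard normal cumulative distribution function `Φ`. -/
noncomputable def stdNormalCDF (x : ℝ) : ℝ :=
  ∫ u in Set.Iic x, stdNormalPDF u

/-- The half-normal hazard rate `α₀(y) = φ(y)/(1 − Φ(y))`. -/
noncomputable def halfNormalHaz (y : ℝ) : ℝ :=
  stdNormalPDF y / (1 - stdNormalCDF y)

noncomputable def millsAux (y : ℝ) : ℝ :=
  ∫ t in Set.Ioi (0 : ℝ), Real.exp (-(y * t) - t ^ 2 / 2)

lemma stdNormalPDF_eq_gauss : stdNormalPDF = ProbabilityTheory.gaussianPDFReal 0 1 := by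
  funext x
  simp [stdNormalPDF, ProbabilityTheory.gaussianPDFReal, div_eq_mul_inv, mul_comm]

lemma stdNormalPDF_integrable : Integrable stdNormalPDF := by
  rw [stdNormalPDF_eq_gauss]; exact ProbabilityTheory.integrable_gaussianPDFReal 0 1

lemma stdNormalPDF_pos (x : ℝ) : 0 < stdNormalPDF x := by
  unfold stdNormalPDF; positivity

lemma stdNormalPDF_add (y t : ℝ) :
    stdNormalPDF (t + y) = stdNormalPDF y * Real.exp (-(y * t) - t ^ 2 / 2) := by
  unfold stdNormalPDF
  rw [div_mul_eq_mul_div, ← Real.exp_add]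
  congr 2; ring

lemma mills_integrable (y : ℝ) :
    Integrable (fun t : ℝ => Real.exp (-(y * t) - t ^ 2 / 2)) := by
  have h := (stdNormalPDF_integrable.comp_add_right y).const_mul (stdNormalPDF y)⁻¹
  refine h.congr (Filter.Eventually.of_forall fun t => ?_)
  have := (stdNormalPDF_pos y).ne'
  simp only [stdNormalPDF_add]
  field_simp

lemma mills_pos (y : ℝ) : 0 < millsAux y := by
  unfold millsAux
  rw [setIntegral_pos_iff_support_of_nonneg_ae
    (Filter.Eventually.of_forall fun t => (Real.exp_pos _).le) (mills_integrable y).integrableOn]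
  have : Function.support (fun t : ℝ => Real.exp (-(y * t) - t ^ 2 / 2)) = Set.univ := by
    ext t; simp [(Real.exp_pos _).ne']
  rw [this]; simp

lemma one_sub_cdf (y : ℝ) : 1 - stdNormalCDF y = stdNormalPDF y * millsAux y := by
  have h1 : ∫ u, stdNormalPDF u = 1 := by
    rw [stdNormalPDF_eq_gauss]
    exact ProbabilityTheory.integral_gaussianPDFReal_eq_one 0 one_ne_zero
  have h2 := intervalIntegral.integral_Iic_add_Ioi (b := y) (μ := volume)
    stdNormalPDF_integrable.integrableOn stdNormalPDF_integrable.integrableOn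
  have h3 : ∫ u in Set.Ioi y, stdNormalPDF u = stdNormalPDF y * millsAux y := by
    have := (measurePreserving_add_right volume y).setIntegral_preimage_emb
      (measurableEmbedding_addRight y) stdNormalPDF (Set.Ioi y)
    rw [← this]
    simp only [stdNormalPDF_add, Set.preimage_add_const_Ioi, sub_self]
    rw [integral_const_mul]; rfl
  unfold stdNormalCDF
  linarith

lemma haz_eq (y : ℝ) : halfNormalHaz y = (millsAux y)⁻¹ := by
  have := (stdNormalPDF_pos y).ne'
  have := (mills_pos y).ne'
  unfold halfNormalHaz
  rw [one_sub_cdf]; field_simp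

lemma haz_pos (y : ℝ) : 0 < halfNormalHaz y := by
  rw [haz_eq]; exact inv_pos.2 (mills_pos y)

lemma haz_mono {x y : ℝ} (h : x ≤ y) : halfNormalHaz x ≤ halfNormalHaz y := by
  rw [haz_eq, haz_eq]
  refine inv_anti₀ (mills_pos y) ?_
  refine setIntegral_mono_on (mills_integrable y).integrableOn (mills_integrable x).integrableOn
    measurableSet_Ioi fun t ht => ?_
  have ht : 0 < t := ht
  have := mul_le_mul_of_nonneg_right h ht.le
  exact Real.exp_le_exp.2 (by linarith)

lemma haz_scale {w : ℝ} (hw : 1 ≤ w) (y : ℝ) :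
    halfNormalHaz (w * y) ≤ w * halfNormalHaz y := by
  have w0 : 0 < w := by linarith
  have key : w⁻¹ * millsAux y ≤ millsAux (w * y) := by
    have h := integral_comp_mul_left_Ioi
      (fun t : ℝ => Real.exp (-(y * t) - t ^ 2 / 2)) 0 w0
    rw [mul_zero, smul_eq_mul] at h
    unfold millsAux
    rw [← h]
    refine setIntegral_mono_on ((mills_integrable y).comp_mul_left' w0.ne').integrableOn
      (mills_integrable (w * y)).integrableOn measurableSet_Ioi fun t _ => ?_
    refine Real.exp_le_exp.2 ?_
    have : 1 * t ^ 2 ≤ w ^ 2 * t ^ 2 :=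
      mul_le_mul_of_nonneg_right (by nlinarith) (sq_nonneg t)
    nlinarith
  rw [haz_eq, haz_eq]
  have h := inv_anti₀ (mul_pos (inv_pos.2 w0) (mills_pos y)) key
  rwa [mul_inv, inv_inv] at h

theorem half_normal_hazard_scale_bounds :
    (∀ w : ℝ, 1 ≤ w → ∀ y : ℝ, 0 ≤ y →
      (halfNormalHaz y ≤ halfNormalHaz (w * y) ∧
        halfNormalHaz (w * y) ≤ (1 + w) * halfNormalHaz y) ∧
      (w ≤ w * halfNormalHaz (w * y) / halfNormalHaz y ∧
        w * halfNormalHaz (w * y) / halfNormalHaz y ≤ w ^ 2 + w)) ∧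
    (∀ w : ℝ, 0 < w → w ≤ 1 → ∀ y : ℝ, 0 ≤ y →
      ((w / (1 + w)) * halfNormalHaz y ≤ halfNormalHaz (w * y) ∧
        halfNormalHaz (w * y) ≤ halfNormalHaz y) ∧
      (w ^ 2 / (1 + w) ≤ w * halfNormalHaz (w * y) / halfNormalHaz y ∧
        w * halfNormalHaz (w * y) / halfNormalHaz y ≤ w)) := by
  refine ⟨fun w hw y hy => ?_, fun w hw hw1 y hy => ?_⟩
  · have hp := haz_pos y
    have h1 : halfNormalHaz y ≤ halfNormalHaz (w * y) := haz_mono (by nlinarith)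
    have h2 : halfNormalHaz (w * y) ≤ (1 + w) * halfNormalHaz y := by
      have := haz_scale hw y
      linarith
    refine ⟨⟨h1, h2⟩, ?_, ?_⟩
    · rw [le_div_iff₀ hp]
      exact mul_le_mul_of_nonneg_left h1 (by linarith)
    · rw [div_le_iff₀ hp]
      have := mul_le_mul_of_nonneg_left h2 (by linarith : 0 ≤ w)
      linarith
  · have hp := haz_pos y
    have h1 : halfNormalHaz (w * y) ≤ halfNormalHaz y := haz_mono (by nlinarith)
    have h2 : (w / (1 + w)) * halfNormalHaz y ≤ halfNormalHaz (w * y) := by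
      have h := haz_scale ((one_le_inv₀ hw).2 hw1) (w * y)
      rw [inv_mul_cancel_left₀ hw.ne', ← div_eq_inv_mul, le_div_iff₀ hw] at h
      have h3 : w / (1 + w) ≤ w := div_le_self hw.le (by linarith)
      have := mul_le_mul_of_nonneg_right h3 hp.le
      linarith
    refine ⟨⟨h2, h1⟩, ?_, ?_⟩
    · rw [le_div_iff₀ hp]
      have := mul_le_mul_of_nonneg_left h2 hw.le
      calc w ^ 2 / (1 + w) * halfNormalHaz y = w * (w / (1 + w) * halfNormalHaz y) := by ring
        _ ≤ _ := this
    · rw [div_le_iff₀ hp]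
      exact mul_le_mul_of_nonneg_left h1 hw.le
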